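/- arXiv:1802.09849 — 3 statements merged into one kernel-verified Lean document; each statement's English description precedes it below -/
import Mathlib

section
/- Let k ≥ 1 and A ≥ 1 be integers. Let T be a set of at most A polynomials in ℤ[x_1,…,x_k], each of total degree at most A, and let d ≥ 0 be an integer such that for every prime p, the Krull dimension of F̄_p[x_1,…,x_k]/(ideal generated by the images of T) is at most d (equivalently, the zero locus of T in an algebraic closure of F_p has dimension at most d). Then there exists a constant C depending only on k and A such that for every prime p and every integer B with 0 ≤ B < p/2, the number of points x = (x_1,…,x_k) ∈ (ℤ/pℤ)^k satisfying f(x) = 0 for all f ∈ T and such that, for each i, x_i ≠ 0 and the integer representative of x_i in {1,…,p−1} lies in the interval [B, 2B], is at most C·B^d. -/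
open scoped Classical

universe u v w

theorem natCard_le_ringKrullDim_of_injective {K : Type u} {ι : Type v} {B : Type w}
    [Field K] [Finite ι] [CommRing B] [Algebra K B] [Algebra.FiniteType K B]
    (φ : MvPolynomial ι K →ₐ[K] B) (hφ : Function.Injective φ) :
    (Nat.card ι : WithBot ℕ∞) ≤ ringKrullDim B := by
  obtain ⟨q, hq, hqφ⟩ := Ideal.exists_comap_eq_of_mem_minimalPrimes_of_injective
    (f := φ.toRingHom) hφ ⊥ (by simp [IsDomain.minimalPrimes_eq_singleton_bot])
  refine le_trans ?_ (ringKrullDim_quotient_le q)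
  let ψ : MvPolynomial ι K →ₐ[K] B ⧸ q := (Ideal.Quotient.mkₐ K q).comp φ
  have hψ : Function.Injective ψ := by
    rw [injective_iff_map_eq_zero]
    intro a ha
    have h : φ a ∈ q := Ideal.Quotient.eq_zero_iff_mem.mp ha
    change a ∈ Ideal.comap φ.toRingHom q at h
    rw [hqφ] at h
    exact h
  obtain ⟨s, g, hg, hgi⟩ := exists_integral_inj_algHom_of_fg K (B ⧸ q)
  have hind : AlgebraicIndependent K (fun i => ψ (MvPolynomial.X i)) := by
    rw [AlgebraicIndependent]
    convert! hψ
    ext; simp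
  let _ : Algebra (MvPolynomial (Fin s) K) (B ⧸ q) := g.toRingHom.toAlgebra
  have : Algebra.IsIntegral (MvPolynomial (Fin s) K) (B ⧸ q) := ⟨hgi⟩
  have hinj : Function.Injective (algebraMap (MvPolynomial (Fin s) K) (B ⧸ q)) := hg
  have hcard : Nat.card ι ≤ s := by
    have : FaithfulSMul (MvPolynomial (Fin s) K) (B ⧸ q) :=
      (faithfulSMul_iff_algebraMap_injective _ _).mpr hinj
    have : IsScalarTower K (MvPolynomial (Fin s) K) (B ⧸ q) :=
      IsScalarTower.of_algebraMap_eq fun x => (g.commutes x).symm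
    have hb := lift_trdeg_add_eq K (MvPolynomial (Fin s) K) (B ⧸ q)
    rw [MvPolynomial.trdeg_of_isDomain, trdeg_eq_zero] at hb
    have hs : Algebra.trdeg K (B ⧸ q) = s := by
      rw [← Cardinal.lift_inj.{w, u}, ← hb]
      simp
    have h := hind.lift_cardinalMk_le_trdeg
    rw [hs, ← Nat.cast_card] at h
    simpa using h
  calc (Nat.card ι : WithBot ℕ∞) ≤ s := by exact_mod_cast hcard
    _ = ringKrullDim (MvPolynomial (Fin s) K) := by
      simp [MvPolynomial.ringKrullDim_of_isNoetherianRing, ringKrullDim_eq_zero_of_field]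
    _ ≤ _ := by
      refine iSup_le fun l => ?_
      obtain ⟨Q, hQ, hQl⟩ := Ideal.exists_ideal_over_prime_of_isIntegral_of_isDomain
        (S := B ⧸ q) l.head.asIdeal
        (by rw [(RingHom.injective_iff_ker_eq_bot _).mp hinj]; exact bot_le)
      have : Q.LiesOver l.head.asIdeal := ⟨hQl.symm⟩
      obtain ⟨l', hl', -⟩ := Ideal.exists_ltSeries_of_hasGoingUp l Q
      rw [← hl']
      exact Order.LTSeries.length_le_krullDim l'

theorem nonempty_algHom_of_finiteType {F B L : Type*} [Field F] [CommRing B] [Nontrivial B]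
    [Algebra F B] [Algebra.FiniteType F B] [Field L] [IsAlgClosed L] [Algebra F L] :
    Nonempty (B →ₐ[F] L) := by
  obtain ⟨m, hm⟩ := Ideal.exists_maximal B
  let _ : Field (B ⧸ m) := Ideal.Quotient.field m
  have : Module.Finite F (B ⧸ m) := finite_of_finite_type_of_isJacobsonRing _ _
  exact ⟨(IsAlgClosed.lift : (B ⧸ m) →ₐ[F] L).comp (Ideal.Quotient.mkₐ F m)⟩

theorem nonempty_algHom_of_injective {R B L : Type*} [CommRing R] [IsDomain R] [CommRing B]
    [Algebra R B] [Algebra.FiniteType R B] [Field L] [IsAlgClosed L] [Algebra R L]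
    (hB : Function.Injective (algebraMap R B)) (hL : Function.Injective (algebraMap R L)) :
    Nonempty (B →ₐ[R] L) := by
  let F := FractionRing R
  have : FaithfulSMul R L := (faithfulSMul_iff_algebraMap_injective R L).mpr hL
  let _ : Algebra F L := FractionRing.liftAlgebra R L
  have : IsScalarTower R F L := FractionRing.isScalarTower_liftAlgebra R L
  have hi : Function.Injective (Algebra.TensorProduct.includeLeft : F →ₐ[R] TensorProduct R F B) :=
    Algebra.TensorProduct.includeLeft_injective hB
  have : Nontrivial (TensorProduct R F B) := hi.nontrivial
  obtain ⟨θ⟩ := nonempty_algHom_of_finiteType (F := F) (B := TensorProduct R F B) (L := L)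
  exact ⟨(θ.restrictScalars R).comp Algebra.TensorProduct.includeRight⟩

/-- The ideal of families that vanish along an ultrafilter. -/
def ultraproductIdeal {ι : Type*} (U : Ultrafilter ι) (K : ι → Type*) [∀ n, Field (K n)] :
    Ideal (∀ n, K n) where
  carrier := {a | ∀ᶠ n in U, a n = 0}
  zero_mem' := Filter.Eventually.of_forall fun _ => rfl
  add_mem' ha hb := by
    filter_upwards [ha, hb] with n h₁ h₂
    simp [h₁, h₂]
  smul_mem' c a ha := by
    filter_upwards [ha] with n h
    simp [h]

theorem mem_ultraproductIdeal {ι : Type*} {U : Ultrafilter ι} {K : ι → Type*}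
    [∀ n, Field (K n)] {a : ∀ n, K n} :
    a ∈ ultraproductIdeal U K ↔ ∀ᶠ n in U, a n = 0 := Iff.rfl

instance ultraproductIdeal_isMaximal {ι : Type*} (U : Ultrafilter ι) (K : ι → Type*)
    [∀ n, Field (K n)] : (ultraproductIdeal U K).IsMaximal := by
  rw [Ideal.isMaximal_iff]
  refine ⟨fun h => ?_, fun J a hJ ha haJ => ?_⟩
  · obtain ⟨n, hn⟩ := (mem_ultraproductIdeal.mp h).exists
    exact one_ne_zero hn
  · have ha' : ∀ᶠ n in U, a n ≠ 0 := Ultrafilter.eventually_not.mpr ha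
    have h1 : 1 - a * (fun n => (a n)⁻¹) ∈ ultraproductIdeal U K := by
      filter_upwards [ha'] with n hn
      simp [hn]
    simpa using J.add_mem (hJ h1) (J.mul_mem_right (fun n => (a n)⁻¹) haJ)

/-- The ultraproduct of a family of fields. -/
abbrev FieldUltraproduct {ι : Type*} (U : Ultrafilter ι) (K : ι → Type*) [∀ n, Field (K n)] :=
  (∀ n, K n) ⧸ ultraproductIdeal U K

noncomputable instance {ι : Type*} (U : Ultrafilter ι) (K : ι → Type*) [∀ n, Field (K n)] :
    Field (FieldUltraproduct U K) :=
  Ideal.Quotient.field _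

instance {ι : Type*} (U : Ultrafilter ι) (K : ι → Type*) [∀ n, Field (K n)]
    [∀ n, IsAlgClosed (K n)] : IsAlgClosed (FieldUltraproduct U K) := by
  refine IsAlgClosed.of_exists_root _ fun p hp hirr => ?_
  obtain ⟨q, hq, hdeg, hmon⟩ := Polynomial.lifts_and_natDegree_eq_and_monic
    (Polynomial.map_surjective _ Ideal.Quotient.mk_surjective p) hp
  have : Nontrivial (∀ n, K n) :=
    (Ideal.Quotient.mk_surjective (I := ultraproductIdeal U K)).nontrivial
  have hroot : ∀ n, ∃ z : K n, (q.map (Pi.evalRingHom K n)).eval z = 0 := fun n => by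
    refine IsAlgClosed.exists_root _ ?_
    rw [hmon.degree_map, Polynomial.degree_eq_natDegree hmon.ne_zero, hdeg]
    exact_mod_cast hirr.natDegree_pos.ne'
  choose z hz using hroot
  refine ⟨Ideal.Quotient.mk _ z, ?_⟩
  have hqz : q.eval z = 0 := by
    funext n
    have h := Polynomial.hom_eval₂ q (RingHom.id _) (Pi.evalRingHom K n) z
    rw [RingHom.comp_id] at h
    exact h.trans ((Polynomial.eval_map _ _).symm.trans (hz n))
  rw [← hq, Polynomial.eval_map, Polynomial.eval₂_hom, hqz, map_zero]

theorem map_mk_ultraproductIdeal_eq_zero_iff {ι σ : Type*} {U : Ultrafilter ι} {K : ι → Type*}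
    [∀ n, Field (K n)] (C : MvPolynomial σ (∀ n, K n)) :
    MvPolynomial.map (Ideal.Quotient.mk (ultraproductIdeal U K)) C = 0 ↔
      ∀ᶠ n in U, MvPolynomial.map (Pi.evalRingHom K n) C = 0 := by
  have h : ∀ n, MvPolynomial.map (Pi.evalRingHom K n) C = 0 ↔ ∀ e ∈ C.support, C.coeff e n = 0 := by
    intro n
    rw [MvPolynomial.ext_iff]
    refine ⟨fun h e _ => by simpa [MvPolynomial.coeff_map] using h e, fun h e => ?_⟩
    by_cases he : e ∈ C.support
    · simpa [MvPolynomial.coeff_map] using h e he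
    · simp [MvPolynomial.coeff_map, MvPolynomial.notMem_support_iff.mp he]
  simp_rw [h, Filter.eventually_all_finset, ← mem_ultraproductIdeal]
  rw [MvPolynomial.ext_iff]
  simp only [MvPolynomial.coeff_map, Ideal.Quotient.eq_zero_iff_mem, MvPolynomial.coeff_zero]
  refine ⟨fun h e _ => h e, fun h e => ?_⟩
  by_cases he : e ∈ C.support
  · exact h e he
  · simp [MvPolynomial.notMem_support_iff.mp he]

theorem exists_map_evalRingHom_eq {ι σ : Type*} [Finite σ] {K : ι → Type*} [∀ n, Field (K n)]
    (A : ℕ) (f : ∀ n, MvPolynomial σ (K n)) (hf : ∀ n, (f n).totalDegree ≤ A) :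
    ∃ F : MvPolynomial σ (∀ n, K n), ∀ n, MvPolynomial.map (Pi.evalRingHom K n) F = f n := by
  have hfin : {e : σ →₀ ℕ | e.degree ≤ A}.Finite := Finsupp.finite_of_degree_le A
  refine ⟨∑ e ∈ hfin.toFinset, MvPolynomial.monomial e fun n => (f n).coeff e, fun n => ?_⟩
  simp only [map_sum, MvPolynomial.map_monomial, Pi.evalRingHom_apply]
  conv_rhs => rw [(f n).as_sum]
  refine (Finset.sum_subset (fun e he => ?_) fun e _ he => ?_).symm
  · rw [Set.Finite.mem_toFinset]
    exact (MvPolynomial.le_totalDegree he).trans (hf n)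
  · simp [MvPolynomial.notMem_support_iff.mp he]

/-- The map of ultraproducts induced by a family of ring homomorphisms. -/
noncomputable def FieldUltraproduct.map {ι : Type*} (U : Ultrafilter ι) {K : ι → Type*}
    {L : ι → Type*} [∀ n, Field (K n)] [∀ n, Field (L n)] (j : ∀ n, K n →+* L n) :
    FieldUltraproduct U K →+* FieldUltraproduct U L :=
  Ideal.quotientMap _ (RingHom.pi fun n => (j n).comp (Pi.evalRingHom K n)) fun a ha => by
    filter_upwards [ha] with n hn
    change j n (a n) = 0
    rw [hn, map_zero]

theorem FieldUltraproduct.eval₂_map_mk {ι σ : Type*} (U : Ultrafilter ι) {K : ι → Type*}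
    {L : ι → Type*} [∀ n, Field (K n)] [∀ n, Field (L n)] (j : ∀ n, K n →+* L n)
    (z : σ → ∀ n, L n) (C : MvPolynomial σ (∀ n, K n)) :
    MvPolynomial.eval₂ (FieldUltraproduct.map U j) (fun s => Ideal.Quotient.mk _ (z s))
        (MvPolynomial.map (Ideal.Quotient.mk (ultraproductIdeal U K)) C) =
      Ideal.Quotient.mk (ultraproductIdeal U L) fun n => MvPolynomial.eval₂ (j n)
        (fun s => z s n) (MvPolynomial.map (Pi.evalRingHom K n) C) := by
  have h : (fun n => MvPolynomial.eval₂ (j n) (fun s => z s n)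
      (MvPolynomial.map (Pi.evalRingHom K n) C)) =
      MvPolynomial.eval₂ (RingHom.pi fun n => (j n).comp (Pi.evalRingHom K n)) z C := by
    funext n
    rw [MvPolynomial.eval₂_map]
    exact (MvPolynomial.eval₂_comp_left (Pi.evalRingHom L n)
      (RingHom.pi fun n => (j n).comp (Pi.evalRingHom K n)) z C).symm
  rw [h, MvPolynomial.eval₂_map, MvPolynomial.eval₂_comp_left]
  rfl

theorem totalDegree_map_le_totalDegree {R S σ : Type*} [CommSemiring R] [CommSemiring S]
    (f : R →+* S) (p : MvPolynomial σ R) : (MvPolynomial.map f p).totalDegree ≤ p.totalDegree :=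
  Finset.sup_mono (MvPolynomial.support_map_subset f p)

/-- If every nonzero polynomial contracted from the `n`-th ideal has degree greater than `n`, then
the ideal over the ultraproduct has zero contraction. -/
theorem comap_rename_span_ultraproduct_eq_bot {σ τ ι : Type*} [Fintype ι] (ρ : τ → σ)
    {K : ℕ → Type*} [∀ n, Field (K n)] (F : ι → MvPolynomial σ (∀ n, K n))
    (h : ∀ (n : ℕ) (c : MvPolynomial τ (K n)), c ≠ 0 → MvPolynomial.rename ρ c ∈
      Ideal.span (Set.range fun i => MvPolynomial.map (Pi.evalRingHom K n) (F i)) →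
        n < c.totalDegree) :
    Ideal.comap (MvPolynomial.rename ρ) (Ideal.span (Set.range fun i => MvPolynomial.map
      (Ideal.Quotient.mk (ultraproductIdeal (Filter.hyperfilter ℕ) K)) (F i))) = ⊥ := by
  rw [eq_bot_iff]
  intro c hc
  by_contra hc0
  obtain ⟨c, rfl⟩ := MvPolynomial.map_surjective _ Ideal.Quotient.mk_surjective c
  rw [Ideal.mem_comap, Ideal.mem_span_range_iff_exists_fun] at hc
  obtain ⟨G, hG⟩ := hc
  choose g hg using fun i => MvPolynomial.map_surjective _ Ideal.Quotient.mk_surjective (G i)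
  have hsub : MvPolynomial.map (Ideal.Quotient.mk (ultraproductIdeal (Filter.hyperfilter ℕ) K))
      (MvPolynomial.rename ρ c - ∑ i, g i * F i) = 0 := by
    simp only [map_sub, map_sum, map_mul, hg, hG, MvPolynomial.map_rename, sub_self]
  rw [Ideal.mem_bot, map_mk_ultraproductIdeal_eq_zero_iff, ← Ultrafilter.eventually_not] at hc0
  obtain ⟨n, ⟨hn0, hns⟩, hn⟩ := ((hc0.and ((map_mk_ultraproductIdeal_eq_zero_iff _).mp hsub)).and
    (Nat.hyperfilter_le_atTop (Filter.eventually_ge_atTop c.totalDegree))).exists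
  refine ((h n _ hn0 ?_).trans_le (totalDegree_map_le_totalDegree _ c)).not_ge hn
  rw [Ideal.mem_span_range_iff_exists_fun]
  refine ⟨fun i => MvPolynomial.map (Pi.evalRingHom K n) (g i), ?_⟩
  rw [map_sub, sub_eq_zero] at hns
  simp only [← MvPolynomial.map_rename, hns, map_sum, map_mul]

theorem exists_ringHom_of_comap_rename_eq_bot {σ τ F Ω : Type*} [Finite σ] [Field F] [Field Ω]
    [IsAlgClosed Ω] (ρ : τ → σ) (I : Ideal (MvPolynomial σ F))
    (hI : Ideal.comap (MvPolynomial.rename ρ) I = ⊥) (ψ : MvPolynomial τ F →+* Ω)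
    (hψ : Function.Injective ψ) :
    ∃ Θ : MvPolynomial σ F →+* Ω, (∀ a ∈ I, Θ a = 0) ∧
      ∀ c, Θ (MvPolynomial.rename ρ c) = ψ c := by
  let φ : MvPolynomial τ F →ₐ[F] MvPolynomial σ F ⧸ I :=
    (Ideal.Quotient.mkₐ F I).comp (MvPolynomial.rename ρ)
  have hφ : Function.Injective φ := by
    rw [injective_iff_map_eq_zero]
    intro c hc
    have h : MvPolynomial.rename ρ c ∈ I := Ideal.Quotient.eq_zero_iff_mem.mp hc
    rwa [← Ideal.mem_comap, hI] at h
  algebraize [φ.toRingHom, ψ]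
  have : IsScalarTower F (MvPolynomial τ F) (MvPolynomial σ F ⧸ I) :=
    IsScalarTower.of_algebraMap_eq fun a => (φ.commutes a).symm
  have : Algebra.FiniteType (MvPolynomial τ F) (MvPolynomial σ F ⧸ I) :=
    Algebra.FiniteType.of_restrictScalars_finiteType F _ _
  obtain ⟨θ⟩ := nonempty_algHom_of_injective (R := MvPolynomial τ F)
    (B := MvPolynomial σ F ⧸ I) (L := Ω) hφ hψ
  refine ⟨θ.toRingHom.comp (Ideal.Quotient.mk I), fun a ha => ?_, θ.commutes⟩
  change θ (Ideal.Quotient.mk I a) = 0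
  rw [Ideal.Quotient.eq_zero_iff_mem.mpr ha, map_zero]

theorem exists_totalDegree_le_of_comap_rename_span_ne_bot {σ τ ι : Type*} [Finite σ] [Finite τ]
    [Fintype ι] (ρ : τ → σ) (A : ℕ) :
    ∃ D : ℕ, ∀ (K : Type u) [Field K] (f : ι → MvPolynomial σ K), (∀ i, (f i).totalDegree ≤ A) →
      Ideal.comap (MvPolynomial.rename ρ) (Ideal.span (Set.range f)) ≠ ⊥ →
      ∃ c : MvPolynomial τ K, c ≠ 0 ∧ MvPolynomial.rename ρ c ∈ Ideal.span (Set.range f) ∧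
        c.totalDegree ≤ D := by
  by_contra! hcon
  choose K hK f hfA hne hdeg using hcon
  choose F hF using fun i => exists_map_evalRingHom_eq A (fun n => f n i) (fun n => hfA n i)
  let U : Ultrafilter ℕ := Filter.hyperfilter ℕ
  let Fs : ι → MvPolynomial σ (FieldUltraproduct U K) := fun i =>
    MvPolynomial.map (Ideal.Quotient.mk (ultraproductIdeal U K)) (F i)
  let I : Ideal (MvPolynomial σ (FieldUltraproduct U K)) := Ideal.span (Set.range Fs)
  have hI : Ideal.comap (MvPolynomial.rename ρ) I = ⊥ :=
    comap_rename_span_ultraproduct_eq_bot ρ F fun n c hc hcI =>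
      hdeg n c hc (by simpa only [hF] using hcI)
  let L : ℕ → Type _ := fun n => AlgebraicClosure (FractionRing (MvPolynomial τ (K n)))
  let e : ∀ n, MvPolynomial τ (K n) →+* L n := fun n =>
    (algebraMap (FractionRing (MvPolynomial τ (K n))) (L n)).comp (algebraMap _ _)
  have he : ∀ n, Function.Injective (e n) := fun n =>
    (algebraMap (FractionRing (MvPolynomial τ (K n))) (L n)).injective.comp
      (IsFractionRing.injective _ _)
  let j : ∀ n, K n →+* L n := fun n => (e n).comp MvPolynomial.C
  let x : τ → ∀ n, L n := fun t n => e n (MvPolynomial.X t)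
  have hx : ∀ n (c : MvPolynomial τ (K n)),
      MvPolynomial.eval₂ (j n) (fun t => x t n) c = e n c := fun n c => by
    conv_rhs => rw [← MvPolynomial.eval₂_eta c, MvPolynomial.eval₂_comp_left]
    rfl
  let ψ : MvPolynomial τ (FieldUltraproduct U K) →+* FieldUltraproduct U L :=
    MvPolynomial.eval₂Hom (FieldUltraproduct.map U j) fun t => Ideal.Quotient.mk _ (x t)
  have hψ : Function.Injective ψ := by
    rw [injective_iff_map_eq_zero]
    intro c hc
    obtain ⟨c, rfl⟩ := MvPolynomial.map_surjective _ Ideal.Quotient.mk_surjective c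
    rw [MvPolynomial.coe_eval₂Hom, FieldUltraproduct.eval₂_map_mk,
      Ideal.Quotient.eq_zero_iff_mem] at hc
    rw [map_mk_ultraproductIdeal_eq_zero_iff]
    filter_upwards [hc] with n hn
    rw [hx] at hn
    exact (injective_iff_map_eq_zero _).mp (he n) _ hn
  obtain ⟨Θ, hΘI, hΘρ⟩ := exists_ringHom_of_comap_rename_eq_bot ρ I hI ψ hψ
  choose z hz using fun s =>
    (Ideal.Quotient.mk_surjective (I := ultraproductIdeal U L)) (Θ (MvPolynomial.X s))
  have hΘ : Θ = MvPolynomial.eval₂Hom (FieldUltraproduct.map U j)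
      fun s => Ideal.Quotient.mk _ (z s) := by
    refine MvPolynomial.ringHom_ext (fun a => ?_) fun s => ?_
    · have h := hΘρ (MvPolynomial.C a)
      rw [MvPolynomial.rename_C] at h
      simp [h, ψ]
    · simp [hz]
  have hzF : ∀ᶠ n in U, ∀ i, MvPolynomial.eval₂ (j n) (fun s => z s n) (f n i) = 0 := by
    rw [Filter.eventually_all]
    intro i
    have h : Θ (Fs i) = 0 := hΘI _ (Ideal.subset_span ⟨i, rfl⟩)
    rw [hΘ, MvPolynomial.coe_eval₂Hom, FieldUltraproduct.eval₂_map_mk,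
      Ideal.Quotient.eq_zero_iff_mem] at h
    filter_upwards [h] with n hn
    rwa [hF] at hn
  have hzx : ∀ᶠ n in U, ∀ t, z (ρ t) n = x t n := by
    rw [Filter.eventually_all]
    intro t
    have h := hΘρ (MvPolynomial.X t)
    rw [MvPolynomial.rename_X, ← hz] at h
    simp only [ψ, MvPolynomial.coe_eval₂Hom, MvPolynomial.eval₂_X] at h
    rw [Ideal.Quotient.eq] at h
    filter_upwards [h] with n hn
    exact sub_eq_zero.mp hn
  obtain ⟨n, hnF, hnx⟩ := (hzF.and hzx).exists
  refine hne n (eq_bot_iff.mpr fun c hc => ?_)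
  have hle : Ideal.span (Set.range (f n)) ≤
      RingHom.ker (MvPolynomial.eval₂Hom (j n) fun s => z s n) := by
    rw [Ideal.span_le]
    rintro _ ⟨i, rfl⟩
    exact hnF i
  have h : MvPolynomial.eval₂ (j n) (fun s => z s n) (MvPolynomial.rename ρ c) = 0 := hle hc
  rw [MvPolynomial.eval₂_rename] at h
  have hcomp : (fun s => z s n) ∘ ρ = fun t => x t n := funext hnx
  rw [hcomp, hx] at h
  exact (injective_iff_map_eq_zero _).mp (he n) _ h

theorem card_le_card_of_degree_le {K σ : Type*} [Field K] (m : MonomialOrder σ)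
    (Z : Finset (σ → K)) (E : Finset (σ →₀ ℕ))
    (h : ∀ e ∉ E, ∃ c : MvPolynomial σ K, c ≠ 0 ∧ (∀ z ∈ Z, MvPolynomial.eval z c = 0) ∧
      m.degree c ≤ e) :
    Z.card ≤ E.card := by
  let v : Z → E → K := fun z e => MvPolynomial.eval z.1 (MvPolynomial.monomial e.1 1)
  suffices hv : LinearIndependent K v by
    simpa using hv.fintype_card_le_finrank
  rw [Fintype.linearIndependent_iff]
  intro a ha
  have hexp : ∀ g : MvPolynomial σ K, ∑ z, a z * MvPolynomial.eval z.1 g =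
      ∑ s ∈ g.support, g.coeff s *
        ∑ z, a z * MvPolynomial.eval z.1 (MvPolynomial.monomial s (1 : K)) := by
    intro g
    simp_rw [Finset.mul_sum]
    rw [Finset.sum_comm]
    refine Finset.sum_congr rfl fun z _ => ?_
    conv_lhs => rw [g.as_sum, map_sum, Finset.mul_sum]
    refine Finset.sum_congr rfl fun s _ => ?_
    simp only [MvPolynomial.eval_monomial]
    ring
  have key : ∀ e : σ →₀ ℕ,
      ∑ z, a z * MvPolynomial.eval z.1 (MvPolynomial.monomial e (1 : K)) = 0 := by
    intro e
    induction e using (InvImage.wf m.toSyn m.wellFoundedLT_syn.wf).induction with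
    | _ e ih =>
    by_cases he : e ∈ E
    · simpa [v] using congrFun ha ⟨e, he⟩
    obtain ⟨c, hc0, hcZ, hce⟩ := h e he
    let g : MvPolynomial σ K := MvPolynomial.monomial (e - m.degree c) 1 * c
    have hdeg : m.degree g = e := by
      rw [m.degree_mul (by simp) hc0, m.degree_monomial]
      simp [tsub_add_cancel_of_le hce]
    have hg0 : g ≠ 0 := mul_ne_zero (by simp) hc0
    have hsum : ∑ s ∈ g.support, g.coeff s *
        ∑ z, a z * MvPolynomial.eval z.1 (MvPolynomial.monomial s (1 : K)) = 0 := by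
      rw [← hexp]
      exact Finset.sum_eq_zero fun z _ => by simp [g, hcZ z.1 z.2]
    have hmem : e ∈ g.support := hdeg ▸ m.degree_mem_support hg0
    rw [Finset.sum_eq_single_of_mem e hmem] at hsum
    · exact (mul_eq_zero.mp hsum).resolve_left (MvPolynomial.mem_support_iff.mp hmem)
    · intro s hs hse
      have hle := m.le_degree hs
      rw [hdeg] at hle
      rw [ih s (lt_of_le_of_ne hle fun h' => hse (m.toSyn.injective h')), mul_zero]
  have hinj : Function.Injective fun z : Z =>
      ((MvPolynomial.eval z.1 : MvPolynomial σ K →+* K) : MvPolynomial σ K →* K) := by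
    intro z w hzw
    ext i
    simpa using congrArg (fun f : MvPolynomial σ K →* K => f (MvPolynomial.X i)) hzw
  have hli := (linearIndependent_monoidHom (MvPolynomial σ K) K).comp _ hinj
  rw [Fintype.linearIndependent_iff] at hli
  refine hli a ?_
  ext g
  have hg := hexp g
  simp_rw [key, mul_zero, Finset.sum_const_zero] at hg
  simpa using hg

theorem card_le_of_forall_exists_vars_subset {K σ : Type*} [Field K] [Fintype σ]
    [LinearOrder σ] (S : Finset K) (hS : S.Nonempty) (D d : ℕ) (Z : Finset (σ → K))
    (hZS : ∀ z ∈ Z, ∀ i, z i ∈ S)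
    (h : ∀ J : Finset σ, J.card = d + 1 → ∃ c : MvPolynomial σ K, c ≠ 0 ∧
      c.vars ⊆ J ∧ c.totalDegree ≤ D ∧ ∀ z ∈ Z, MvPolynomial.eval z c = 0) :
    Z.card ≤ 2 ^ Fintype.card σ * ((D + 1) ^ Fintype.card σ * S.card ^ d) := by
  let Q : Finset (Finset σ) := Finset.univ.filter fun q => q.card ≤ d
  let box : Finset σ → Finset (σ → ℕ) := fun q =>
    Fintype.piFinset fun i => Finset.range (if i ∈ q then S.card else D + 1)
  let E : Finset (σ →₀ ℕ) := (Q.biUnion box).image Finsupp.equivFunOnFinite.symm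
  have hbox : ∀ q ∈ Q, (box q).card ≤ (D + 1) ^ Fintype.card σ * S.card ^ d := by
    intro q hq
    have hqd : q.card ≤ d := (Finset.mem_filter.mp hq).2
    rw [Fintype.card_piFinset]
    simp only [Finset.card_range]
    rw [Finset.prod_ite, Finset.prod_const, Finset.prod_const, mul_comm]
    refine Nat.mul_le_mul ?_ ?_
    · exact Nat.pow_le_pow_right (Nat.succ_pos _) (Finset.card_le_univ _)
    · refine Nat.pow_le_pow_right hS.card_pos ?_
      simpa using hqd
  have hE : E.card ≤ 2 ^ Fintype.card σ * ((D + 1) ^ Fintype.card σ * S.card ^ d) := by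
    refine Finset.card_image_le.trans ((Finset.card_biUnion_le_card_mul _ _ _ hbox).trans ?_)
    refine Nat.mul_le_mul_right _ ?_
    rw [← Fintype.card_finset]
    exact Finset.card_le_univ _
  refine (card_le_card_of_degree_le MonomialOrder.lex Z E fun e he => ?_).trans hE
  let q : Finset σ := Finset.univ.filter fun i => D < e i
  by_cases hq : q.card ≤ d
  · have : ∃ i, S.card ≤ e i := by
      by_contra! hlt
      refine he (Finset.mem_image.mpr ⟨e, Finset.mem_biUnion.mpr ⟨q, by simp [Q, hq], ?_⟩, ?_⟩)
      · rw [Fintype.mem_piFinset]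
        intro i
        by_cases hi : D < e i
        · simp [q, hi, hlt i]
        · simpa [q, hi] using by omega
      · ext; simp
    obtain ⟨i, hi⟩ := this
    have hne : ∀ s : K, (MvPolynomial.X i - MvPolynomial.C s : MvPolynomial σ K) ≠ 0 :=
      fun s => (MonomialOrder.lex.monic_X_sub_C (i := i) (r := s)).ne_zero
    refine ⟨∏ s ∈ S, (MvPolynomial.X i - MvPolynomial.C s),
      Finset.prod_ne_zero_iff.mpr fun s _ => hne s, fun z hz => ?_, ?_⟩
    · rw [map_prod]
      exact Finset.prod_eq_zero (hZS z hz i) (by simp)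
    · rw [MonomialOrder.degree_prod fun s _ => hne s]
      simp [MonomialOrder.degree_X_sub_C, hi]
  · obtain ⟨J, hJq, hJ⟩ := Finset.exists_subset_card_eq (show d + 1 ≤ q.card by omega)
    obtain ⟨c, hc0, hcv, hcD, hcZ⟩ := h J hJ
    refine ⟨c, hc0, hcZ, fun i => ?_⟩
    have hmem := MonomialOrder.lex.degree_mem_support hc0
    by_cases hi : i ∈ J
    · have hDi : D < e i := by simpa [q] using hJq hi
      have h1 := MvPolynomial.le_totalDegree hmem
      have h2 := Finsupp.le_degree i (MonomialOrder.lex.degree c)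
      exact h2.trans ((h1.trans hcD).trans hDi.le)
    · by_contra hlt
      refine hi (hcv ((MvPolynomial.mem_vars_iff_mem_support i).mpr ⟨_, hmem, ?_⟩))
      rw [Finsupp.mem_support_iff]
      omega

theorem comap_rename_ne_bot_of_ringKrullDim_lt {σ τ F : Type*} [Finite σ] [Finite τ] [Field F]
    (ρ : τ → σ) (I : Ideal (MvPolynomial σ F))
    (h : ringKrullDim (MvPolynomial σ F ⧸ I) < (Nat.card τ : WithBot ℕ∞)) :
    Ideal.comap (MvPolynomial.rename ρ) I ≠ ⊥ := by
  intro hI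
  refine h.not_ge (natCard_le_ringKrullDim_of_injective
    ((Ideal.Quotient.mkₐ F I).comp (MvPolynomial.rename ρ)) ?_)
  rw [injective_iff_map_eq_zero]
  intro c hc
  have h : MvPolynomial.rename ρ c ∈ I := Ideal.Quotient.eq_zero_iff_mem.mp hc
  rwa [← Ideal.mem_comap, hI] at h

/-- A set of polynomials of bounded size and degree whose zero locus has dimension at most `d` has
few zeros in a grid, uniformly in the field. -/
theorem exists_card_zeros_le_of_ringKrullDim_le (k A : ℕ) :
    ∃ M : ℕ, ∀ (K : Type u) [Field K] (T : Finset (MvPolynomial (Fin k) K)), T.card ≤ A →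
      (∀ f ∈ T, f.totalDegree ≤ A) → ∀ d : ℕ,
      ringKrullDim (MvPolynomial (Fin k) K ⧸ Ideal.span (T : Set (MvPolynomial (Fin k) K))) ≤
        ((d : ℕ∞) : WithBot ℕ∞) →
      ∀ (S : Finset K), S.Nonempty → ∀ Z : Finset (Fin k → K), (∀ z ∈ Z, ∀ i, z i ∈ S) →
        (∀ z ∈ Z, ∀ f ∈ T, MvPolynomial.eval z f = 0) → Z.card ≤ M * S.card ^ min d k := by
  choose D hD using fun J : Finset (Fin k) =>
    exists_totalDegree_le_of_comap_rename_span_ne_bot.{u} (ι := Fin A) (Subtype.val : J → Fin k) A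
  refine ⟨2 ^ k * (∑ J, D J + 1) ^ k, fun K _ T hTA hTd d hdim S hS Z hZS hZ => ?_⟩
  obtain ⟨f, hfT, hTf⟩ : ∃ f : Fin A → MvPolynomial (Fin k) K,
      (∀ i, f i ∈ T ∨ f i = 0) ∧ ∀ g ∈ T, ∃ i, f i = g := by
    obtain ⟨e⟩ : Nonempty (T ↪ Fin A) :=
      Function.Embedding.nonempty_of_card_le (by simpa using hTA)
    refine ⟨Function.extend e Subtype.val 0, fun i => ?_, fun g hg => ⟨e ⟨g, hg⟩, ?_⟩⟩
    · by_cases hi : ∃ a, e a = i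
      · obtain ⟨a, rfl⟩ := hi
        simp [e.injective.extend_apply]
      · exact Or.inr (Function.extend_apply' _ _ _ hi)
    · rw [e.injective.extend_apply]
  have hspan : Ideal.span (Set.range f) = Ideal.span (T : Set (MvPolynomial (Fin k) K)) := by
    refine le_antisymm (Ideal.span_le.mpr ?_) (Ideal.span_mono fun g hg => hTf g hg)
    rintro _ ⟨i, rfl⟩
    rcases hfT i with h | h
    · exact Ideal.subset_span h
    · simp [h]
  have hfA : ∀ i, (f i).totalDegree ≤ A := fun i => by
    rcases hfT i with h | h
    · exact hTd _ h
    · simp [h]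
  have hvanish : ∀ z ∈ Z, Ideal.span (T : Set (MvPolynomial (Fin k) K)) ≤
      RingHom.ker (MvPolynomial.eval z) := fun z hz => Ideal.span_le.mpr fun g hg => hZ z hz g hg
  have h := card_le_of_forall_exists_vars_subset S hS (∑ J, D J) (min d k) Z hZS fun J hJ => by
    have hJk : J.card ≤ k := (Finset.card_le_univ J).trans_eq (Fintype.card_fin k)
    have hJd : d < J.card := by omega
    obtain ⟨c, hc0, hcI, hcD⟩ := hD J K f hfA (by
      rw [hspan]
      refine comap_rename_ne_bot_of_ringKrullDim_lt _ _ (hdim.trans_lt ?_)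
      rw [Nat.card_eq_fintype_card, Fintype.card_coe]
      exact_mod_cast hJd)
    refine ⟨MvPolynomial.rename Subtype.val c, ?_, fun i hi => ?_, ?_, fun z hz => ?_⟩
    · rwa [Ne, MvPolynomial.rename_eq_zero_iff_of_injective _ Subtype.val_injective]
    · obtain ⟨a, -, rfl⟩ := Finset.mem_image.mp (MvPolynomial.vars_rename _ c hi)
      exact a.2
    · exact (MvPolynomial.totalDegree_rename_le _ c).trans
        (hcD.trans (Finset.single_le_sum (fun _ _ => Nat.zero_le _) (Finset.mem_univ J)))
    · exact hvanish z hz (hspan ▸ hcI)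
  simpa [mul_assoc] using h

/-- Lemma 2.3 (`lm-sz`): counting integral points in a box on a variety modulo `p`. -/
theorem points_in_box_on_variety (k A : ℕ) (hk : 1 ≤ k) (hA : 1 ≤ A) :
    ∃ C : ℝ, ∀ T : Finset (MvPolynomial (Fin k) ℤ), T.card ≤ A →
      (∀ f ∈ T, f.totalDegree ≤ A) →
      ∀ d : ℕ,
      (∀ (p : ℕ) [Fact (Nat.Prime p)],
        ringKrullDim (MvPolynomial (Fin k) (AlgebraicClosure (ZMod p)) ⧸
            Ideal.span ((MvPolynomial.map (Int.castRingHom (AlgebraicClosure (ZMod p)))) ''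
              (T : Set (MvPolynomial (Fin k) ℤ)))) ≤
          ((d : ℕ∞) : WithBot ℕ∞)) →
      ∀ (p : ℕ) [Fact (Nat.Prime p)], ∀ B : ℕ, 2 * B < p →
        (((Finset.univ : Finset (Fin k → ZMod p)).filter (fun x =>
            (∀ f ∈ T, MvPolynomial.aeval x f = 0) ∧
            ∀ i, x i ≠ 0 ∧ B ≤ (x i).val ∧ (x i).val ≤ 2 * B)).card : ℝ) ≤
          C * (B : ℝ) ^ d := by
  obtain ⟨M, hM⟩ := exists_card_zeros_le_of_ringKrullDim_le.{0} k A
  refine ⟨((M * 2 ^ k : ℕ) : ℝ), fun T hTA hTd d hdim p hp B hB => ?_⟩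
  set X : Finset (Fin k → ZMod p) := Finset.univ.filter fun x =>
    (∀ f ∈ T, MvPolynomial.aeval x f = 0) ∧
      ∀ i, x i ≠ 0 ∧ B ≤ (x i).val ∧ (x i).val ≤ 2 * B with hX
  suffices h : X.card ≤ M * 2 ^ k * B ^ d by exact_mod_cast h
  have hXmem : ∀ x ∈ X, (∀ f ∈ T, MvPolynomial.aeval x f = 0) ∧
      ∀ i, x i ≠ 0 ∧ B ≤ (x i).val ∧ (x i).val ≤ 2 * B := fun x hx => by simpa [hX] using hx
  obtain hX0 | ⟨x₀, hx₀⟩ := X.eq_empty_or_nonempty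
  · simp [hX0]
  have hB1 : 1 ≤ B := by
    have h := (hXmem x₀ hx₀).2 ⟨0, hk⟩
    have : (x₀ ⟨0, hk⟩).val ≠ 0 := (ZMod.val_ne_zero _).mpr h.1
    omega
  let K := AlgebraicClosure (ZMod p)
  let a : ZMod p → K := algebraMap (ZMod p) K
  have ha : Function.Injective a := (algebraMap (ZMod p) K).injective
  let I : Finset (ZMod p) := Finset.univ.filter fun y => B ≤ y.val ∧ y.val ≤ 2 * B
  have hIcard : I.card ≤ 2 * B := by
    have h : I.card ≤ (Finset.Icc B (2 * B)).card :=
      Finset.card_le_card_of_injOn ZMod.val (fun y hy => by simpa [I] using hy)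
        (ZMod.val_injective p).injOn
    rw [Nat.card_Icc] at h
    omega
  have hXI : ∀ x ∈ X, ∀ i, x i ∈ I := fun x hx i => by simpa [I] using ((hXmem x hx).2 i).2
  have h := hM K (T.image (MvPolynomial.map (Int.castRingHom K)))
    (Finset.card_image_le.trans hTA)
    (by
      simp only [Finset.mem_image, forall_exists_index, and_imp, forall_apply_eq_imp_iff₂]
      exact fun f hf => (totalDegree_map_le_totalDegree _ f).trans (hTd f hf))
    d (by rw [Finset.coe_image]; exact hdim p) (I.image a)
    (Finset.Nonempty.image ⟨_, hXI x₀ hx₀ ⟨0, hk⟩⟩ a) (X.image (a ∘ ·))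
    (by
      simp only [Finset.mem_image, forall_exists_index, and_imp, forall_apply_eq_imp_iff₂]
      exact fun x hx i => ⟨x i, hXI x hx i, rfl⟩)
    (by
      simp only [Finset.mem_image, forall_exists_index, and_imp, forall_apply_eq_imp_iff₂]
      intro x hx f hf
      rw [MvPolynomial.eval_map]
      have h := MvPolynomial.eval₂_comp_left (algebraMap (ZMod p) K) (algebraMap ℤ (ZMod p)) x f
      rw [← MvPolynomial.aeval_def, (hXmem x hx).1 f hf, map_zero] at h
      rw [h]
      congr 1)
  rw [Finset.card_image_of_injective _ ha.comp_left, Finset.card_image_of_injective _ ha] at h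
  calc X.card ≤ M * I.card ^ min d k := h
    _ ≤ M * (2 * B) ^ min d k := by gcongr
    _ = M * (2 ^ min d k * B ^ min d k) := by rw [mul_pow]
    _ ≤ M * (2 ^ k * B ^ d) := by
      gcongr
      · exact one_le_two
      · exact min_le_right d k
      · exact min_le_left d k
    _ = M * 2 ^ k * B ^ d := (mul_assoc _ _ _).symm
end

section
/- Let q be a prime, k ≥ 1 an integer, and χ = (χ_1,…,χ_k) a k-tuple of complex characters of the finite cyclic group (ℤ/qℤ)^× having Property NIO. Then there exist an integer ν ≥ 1 and a complex character χ_0 of F^×, where F is a finite field with q^ν elements, such that the k-tuple (χ_0·(χ_1∘N), …, χ_0·(χ_k∘N)) of characters of the finite cyclic group F^× has Property CGM, where N : F^× → (ℤ/qℤ)^× is the norm map, i.e. the homomorphism identified with x ↦ x^{(q^ν−1)/(q−1)} on the cyclic group F^×. -/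
open scoped Classical

noncomputable section

/-- The multiset of characters appearing in a `k`-tuple. -/
def charMultiset {A : Type*} [CommGroup A] {k : ℕ} (χ : Fin k → (A →* ℂˣ)) :
    Multiset (A →* ℂˣ) :=
  (List.ofFn χ : List (A →* ℂˣ))

/-- A `k`-tuple of complex characters of `A` is Kummer-induced if there are a divisor
`d ≠ 1` of `k` and characters `ξ_1, …, ξ_{k/d}` such that the multiset of the tuple is,
counted with multiplicity over `j`, the multiset of all characters `η` with `η ^ d = ξ_j`. -/
def IsKummerInduced {A : Type*} [CommGroup A] {k : ℕ} (χ : Fin k → (A →* ℂˣ)) : Prop :=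
  ∃ d : ℕ, d ∣ k ∧ d ≠ 1 ∧ ∃ ξ : Fin (k / d) → (A →* ℂˣ),
    ∀ η : A →* ℂˣ,
      Multiset.count η (charMultiset χ) =
        (Finset.univ.filter fun j : Fin (k / d) => η ^ d = ξ j).card

/-- A tuple is self-dual with dualizing character `ξ` if its multiset is stable
under `η ↦ ξ * η⁻¹`. -/
def IsSelfDualWith {A : Type*} [CommGroup A] {k : ℕ} (χ : Fin k → (A →* ℂˣ))
    (ξ : A →* ℂˣ) : Prop :=
  Multiset.map (fun η => ξ * η⁻¹) (charMultiset χ) = charMultiset χ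

/-- Property NIO: not Kummer-induced, and if `k` is even, every dualizing character `ξ`
satisfies `Λ = ξ ^ (k/2)` (i.e. the tuple is never self-dual symmetric). -/
def HasNIO {A : Type*} [CommGroup A] {k : ℕ} (χ : Fin k → (A →* ℂˣ)) : Prop :=
  ¬ IsKummerInduced χ ∧
    (Even k → ∀ ξ : A →* ℂˣ, IsSelfDualWith χ ξ → (∏ i, χ i) = ξ ^ (k / 2))

/-- Property CGM: not Kummer-induced, `Λ = 1`, and either `k` is odd, or the tuple is not
self-dual, or `k` is even and the tuple is self-dual alternating with trivial dualizing
character. -/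
def HasCGM {A : Type*} [CommGroup A] {k : ℕ} (χ : Fin k → (A →* ℂˣ)) : Prop :=
  ¬ IsKummerInduced χ ∧ (∏ i, χ i) = 1 ∧
    (Odd k ∨ (∀ ξ : A →* ℂˣ, ¬ IsSelfDualWith χ ξ) ∨
      (Even k ∧ IsSelfDualWith χ (1 : A →* ℂˣ) ∧
        (∏ i, χ i) = (1 : A →* ℂˣ) ^ (k / 2)))

/-- The generalized hyper-Kloosterman sum `Kl_k(x; χ, q)`. -/
def Kl (k : ℕ) (q : ℕ) [NeZero q] (χ : Fin k → ((ZMod q)ˣ →* ℂˣ)) (x : ZMod q) : ℂ :=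
  ((q : ℝ) ^ (-(((k : ℝ) - 1) / 2)) : ℝ) *
    ∑ y ∈ Finset.univ.filter
        (fun y : Fin k → (ZMod q)ˣ => (∏ i, ((y i : (ZMod q)ˣ) : ZMod q)) = x),
      (∏ i, ((χ i (y i) : ℂˣ) : ℂ)) *
        Complex.exp (2 * Real.pi * Complex.I *
          (((∑ i, ((y i : (ZMod q)ˣ) : ZMod q)).val : ℝ) / (q : ℝ)))

end

theorem charMultiset_comp {A B : Type*} [CommGroup A] [CommGroup B] {k : ℕ}
    (χ : Fin k → (A →* ℂˣ)) (f : (A →* ℂˣ) → (B →* ℂˣ)) :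
    charMultiset (fun i => f (χ i)) = (charMultiset χ).map f := by
  simp [charMultiset, List.map_ofFn, Function.comp_def]

theorem mem_charMultiset {A : Type*} [CommGroup A] {k : ℕ} {χ : Fin k → (A →* ℂˣ)}
    {η : A →* ℂˣ} : η ∈ charMultiset χ ↔ ∃ i, χ i = η := by
  simp [charMultiset, List.mem_ofFn]

theorem card_charMultiset {A : Type*} [CommGroup A] {k : ℕ} (χ : Fin k → (A →* ℂˣ)) :
    Multiset.card (charMultiset χ) = k := by
  simp [charMultiset]

/-- A character of a cyclic group has at most `d` roots of order `d`. -/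
theorem card_filter_pow_eq_le {B : Type*} [CommGroup B] [IsCyclic B] {d : ℕ} (hd : 0 < d)
    (T : Finset (B →* ℂˣ)) (ξ : B →* ℂˣ) : (T.filter fun η => η ^ d = ξ).card ≤ d := by
  obtain ⟨g, hg⟩ := IsCyclic.exists_generator (α := B)
  calc (T.filter fun η => η ^ d = ξ).card
      ≤ (Polynomial.nthRoots d ((ξ g : ℂˣ) : ℂ)).toFinset.card := by
        apply Finset.card_le_card_of_injOn (fun η => ((η g : ℂˣ) : ℂ))
        · intro η hη
          have h : η ^ d = ξ := (Finset.mem_filter.1 hη).2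
          simp [Polynomial.mem_nthRoots hd, ← h]
        · intro η _ η' _ h
          ext x
          obtain ⟨n, rfl⟩ := hg x
          have h' : η g = η' g := Units.ext h
          simp [map_zpow, h']
    _ ≤ d := (Multiset.toFinset_card_le _).trans (Polynomial.card_nthRoots _ _)

/-- If the fibres of the `d`-th power map over the `ξ j` make up the whole tuple, each is nonempty. -/
theorem exists_pow_eq_of_count_eq {B : Type*} [CommGroup B] [IsCyclic B] {k d : ℕ} (hk : 1 ≤ k)
    (hd : d ∣ k) {χ : Fin k → (B →* ℂˣ)} {ξ : Fin (k / d) → (B →* ℂˣ)}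
    (h : ∀ η : B →* ℂˣ, Multiset.count η (charMultiset χ) =
      (Finset.univ.filter fun j : Fin (k / d) => η ^ d = ξ j).card) (j : Fin (k / d)) :
    ∃ i, χ i ^ d = ξ j := by
  by_contra! hj
  have hd0 : 0 < d := Nat.pos_of_dvd_of_pos hd hk
  set T := (charMultiset χ).toFinset with hT
  have hcard : k = ∑ j, (T.filter fun η => η ^ d = ξ j).card := by
    calc k = ∑ η ∈ T, (charMultiset χ).count η := by
          rw [hT, Multiset.toFinset_sum_count_eq, card_charMultiset]
      _ = ∑ η ∈ T, ∑ j, if η ^ d = ξ j then 1 else 0 := by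
          refine Finset.sum_congr rfl fun η _ => ?_
          rw [h, Finset.card_filter]
      _ = _ := by
          rw [Finset.sum_comm]
          refine Finset.sum_congr rfl fun j _ => ?_
          rw [Finset.card_filter]
  have hlt : ∑ j, (T.filter fun η => η ^ d = ξ j).card < ∑ _j : Fin (k / d), d := by
    refine Finset.sum_lt_sum (fun j _ => card_filter_pow_eq_le hd0 T (ξ j))
      ⟨j, Finset.mem_univ j, ?_⟩
    rwa [Finset.card_eq_zero.2]
    refine Finset.filter_eq_empty_iff.2 fun η hη => ?_
    obtain ⟨i, rfl⟩ := mem_charMultiset.1 (Multiset.mem_toFinset.1 hη)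
    exact hj i
  simp only [Finset.sum_const, Finset.card_univ, Fintype.card_fin, smul_eq_mul,
    Nat.div_mul_cancel hd] at hlt
  omega

theorem comp_injective_of_surjective {A B : Type*} [CommGroup A] [CommGroup B] {N : B →* A}
    (hN : Function.Surjective N) : Function.Injective fun ψ : A →* ℂˣ => ψ.comp N :=
  fun _ _ h => (MonoidHom.cancel_right hN).1 h

theorem twist_injective {A B : Type*} [CommGroup A] [CommGroup B] {N : B →* A}
    (hN : Function.Surjective N) (χ0 : B →* ℂˣ) :
    Function.Injective fun ψ : A →* ℂˣ => χ0 * ψ.comp N :=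
  fun _ _ h => comp_injective_of_surjective hN (mul_left_cancel h)

theorem IsKummerInduced.of_twist {A B : Type*} [CommGroup A] [CommGroup B] [IsCyclic B] {k : ℕ}
    (hk : 1 ≤ k) {N : B →* A} (hN : Function.Surjective N) {χ0 : B →* ℂˣ}
    {χ : Fin k → (A →* ℂˣ)} (h : IsKummerInduced fun i => χ0 * (χ i).comp N) :
    IsKummerInduced χ := by
  obtain ⟨d, hd, hd1, ξ, hξ⟩ := h
  choose i hi using exists_pow_eq_of_count_eq hk hd hξ
  refine ⟨d, hd, hd1, fun j => χ (i j) ^ d, fun ψ => ?_⟩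
  have hc := hξ (χ0 * ψ.comp N)
  rw [charMultiset_comp χ fun ψ => χ0 * ψ.comp N,
    Multiset.count_map_eq_count' _ _ (twist_injective hN χ0)] at hc
  rw [hc]
  congr 1
  ext j
  simp only [Finset.mem_filter, Finset.mem_univ, true_and]
  have hpow (φ : A →* ℂˣ) : (χ0 * φ.comp N) ^ d = χ0 ^ d * (φ ^ d).comp N :=
    MonoidHom.ext fun x => mul_pow (χ0 x) (φ (N x)) d
  rw [← hi j, hpow, hpow]
  exact (twist_injective hN (χ0 ^ d)).eq_iff (a := ψ ^ d) (b := χ (i j) ^ d)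

theorem isSelfDualWith_twist_iff {A B : Type*} [CommGroup A] [CommGroup B] {k : ℕ}
    {N : B →* A} (hN : Function.Surjective N) (χ0 : B →* ℂˣ) (χ : Fin k → (A →* ℂˣ))
    (ξ : A →* ℂˣ) :
    IsSelfDualWith (fun i => χ0 * (χ i).comp N) (χ0 ^ 2 * ξ.comp N) ↔ IsSelfDualWith χ ξ := by
  rw [IsSelfDualWith, IsSelfDualWith, charMultiset_comp χ fun ψ => χ0 * ψ.comp N,
    ← (Multiset.map_injective (twist_injective hN χ0)).eq_iff, Multiset.map_map, Multiset.map_map]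
  have : (fun η => χ0 ^ 2 * ξ.comp N * η⁻¹) ∘ (fun ψ : A →* ℂˣ => χ0 * ψ.comp N) =
      (fun ψ : A →* ℂˣ => χ0 * ψ.comp N) ∘ fun η => ξ * η⁻¹ := by
    funext ψ
    refine MonoidHom.ext fun x => ?_
    change χ0 x ^ 2 * ξ (N x) * (χ0 x * ψ (N x))⁻¹ = χ0 x * (ξ (N x) * (ψ (N x))⁻¹)
    rw [pow_two, mul_inv, mul_mul_mul_comm, mul_inv_cancel_right]
  rw [this]

theorem IsSelfDualWith.exists_of_twist {A B : Type*} [CommGroup A] [CommGroup B] {k : ℕ}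
    (hk : 1 ≤ k) {N : B →* A} (hN : Function.Surjective N) {χ0 ξ : B →* ℂˣ}
    {χ : Fin k → (A →* ℂˣ)} (h : IsSelfDualWith (fun i => χ0 * (χ i).comp N) ξ) :
    ∃ ξ', IsSelfDualWith χ ξ' := by
  have h0 : χ0 * (χ ⟨0, hk⟩).comp N ∈ charMultiset fun i => χ0 * (χ i).comp N :=
    mem_charMultiset.2 ⟨⟨0, hk⟩, rfl⟩
  have h1 := Multiset.mem_map_of_mem (fun η => ξ * η⁻¹) h0
  rw [h] at h1
  obtain ⟨i, hi⟩ := mem_charMultiset.1 h1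
  have hξ : ξ = χ0 ^ 2 * (χ i * χ ⟨0, hk⟩).comp N := by
    refine MonoidHom.ext fun x => ?_
    have hx : χ0 x * χ i (N x) = ξ x * (χ0 x * χ ⟨0, hk⟩ (N x))⁻¹ := DFunLike.congr_fun hi x
    change ξ x = χ0 x ^ 2 * (χ i (N x) * χ ⟨0, hk⟩ (N x))
    rw [← eq_mul_inv_iff_mul_eq.1 hx, mul_mul_mul_comm, pow_two]
  rw [hξ, isSelfDualWith_twist_iff hN] at h
  exact ⟨_, h⟩

theorem prod_twist {A B : Type*} [CommGroup A] [CommGroup B] {k : ℕ} (N : B →* A)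
    (χ0 : B →* ℂˣ) (χ : Fin k → (A →* ℂˣ)) :
    ∏ i, χ0 * (χ i).comp N = χ0 ^ k * (∏ i, χ i).comp N := by
  rw [Finset.prod_mul_distrib, Finset.prod_const, Finset.card_univ, Fintype.card_fin]
  congr 1
  ext x
  simp [MonoidHom.finsetProd_apply]

/-- Property NIO gives Property CGM after a twist, provided enough pulled back characters
are powers. -/
theorem HasNIO.exists_hasCGM_twist {A B : Type*} [CommGroup A] [CommGroup B] [IsCyclic B] {k : ℕ}
    (hk : 1 ≤ k) {N : B →* A} (hN : Function.Surjective N)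
    (hpow : ∀ n, n ∣ k → ∀ ψ : A →* ℂˣ, ∃ χ0 : B →* ℂˣ, χ0 ^ n = ψ.comp N)
    {χ : Fin k → (A →* ℂˣ)} (hχ : HasNIO χ) :
    ∃ χ0 : B →* ℂˣ, HasCGM fun i => χ0 * (χ i).comp N := by
  by_cases hsd : Even k ∧ ∃ ξ, IsSelfDualWith χ ξ
  · obtain ⟨hke, ξ, hξ⟩ := hsd
    obtain ⟨χ0, h0⟩ := hpow 2 hke.two_dvd ξ⁻¹
    have h0' : χ0 ^ 2 * ξ.comp N = 1 := by
      rw [h0, ← MonoidHom.mul_comp, inv_mul_cancel, MonoidHom.one_comp]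
    have hprod : ∏ i, χ0 * (χ i).comp N = 1 := by
      rw [prod_twist, hχ.2 hke ξ hξ]
      refine MonoidHom.ext fun x => ?_
      have hx : χ0 x ^ 2 * ξ (N x) = 1 := DFunLike.congr_fun h0' x
      change χ0 x ^ k * ξ (N x) ^ (k / 2) = 1
      conv_lhs => enter [1]; rw [← Nat.mul_div_cancel' hke.two_dvd, pow_mul]
      rw [← mul_pow, hx, one_pow]
    refine ⟨χ0, fun h => hχ.1 (h.of_twist hk hN), hprod, Or.inr (Or.inr ⟨hke, ?_, ?_⟩)⟩
    · rw [← h0']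
      exact (isSelfDualWith_twist_iff hN χ0 χ ξ).2 hξ
    · exact hprod.trans (one_pow (M := B →* ℂˣ) (k / 2)).symm
  · obtain ⟨χ0, h0⟩ := hpow k dvd_rfl (∏ i, χ i)⁻¹
    refine ⟨χ0, fun h => hχ.1 (h.of_twist hk hN), ?_, ?_⟩
    · rw [prod_twist, h0, ← MonoidHom.mul_comp, inv_mul_cancel, MonoidHom.one_comp]
    · rcases Nat.even_or_odd k with hke | hko
      · exact Or.inr (Or.inl fun ξ h => hsd ⟨hke, h.exists_of_twist hk hN⟩)
      · exact Or.inl hko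

/-- Characters of a group of exponent dividing `q - 1` become `q ^ a * m`-th powers after pulling
back to a cyclic group whose order is divisible by `m * (q - 1)`. -/
theorem exists_pow_eq_comp {A B : Type*} [CommGroup A] [CommGroup B] [IsCyclic B] {q a m : ℕ}
    (hq : 1 ≤ q) (hm : m ≠ 0) (hA : ∀ x : A, x ^ (q - 1) = 1) (hB : m * (q - 1) ∣ Nat.card B)
    (N : B →* A) (ψ : A →* ℂˣ) : ∃ χ0 : B →* ℂˣ, χ0 ^ (q ^ a * m) = ψ.comp N := by
  obtain ⟨g, hg⟩ := IsCyclic.exists_generator (α := B)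
  have hw : ψ (N g) ^ (q - 1) = 1 := by rw [← map_pow, hA, map_one]
  have hwq : ψ (N g) ^ q = ψ (N g) := by
    rw [← Nat.sub_add_cancel hq, pow_succ, hw, one_mul]
  have hwqa : ∀ a : ℕ, ψ (N g) ^ q ^ a = ψ (N g) := fun a => by
    induction a with
    | zero => simp
    | succ a ih => rw [pow_succ, pow_mul, ih, hwq]
  obtain ⟨z, hz⟩ : ∃ z : ℂˣ, z ^ m = ψ (N g) := by
    obtain ⟨z, hz⟩ := IsAlgClosed.exists_pow_nat_eq ((ψ (N g) : ℂˣ) : ℂ) (Nat.pos_of_ne_zero hm)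
    have hz0 : z ≠ 0 := by
      rintro rfl
      rw [zero_pow hm] at hz
      exact (ψ (N g)).ne_zero hz.symm
    exact ⟨Units.mk0 z hz0, Units.ext (by simpa using hz)⟩
  have hord : orderOf z ∣ orderOf g := by
    rw [orderOf_eq_card_of_forall_mem_zpowers hg]
    exact (orderOf_dvd_of_pow_eq_one (by rw [pow_mul, hz, hw])).trans hB
  refine ⟨monoidHomOfForallMemZpowers hg hord, ?_⟩
  have hgen : (monoidHomOfForallMemZpowers hg hord ^ (q ^ a * m)) g = ψ.comp N g := by
    rw [MonoidHom.pow_apply, monoidHomOfForallMemZpowers_apply_gen, mul_comm, pow_mul, hz, hwqa]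
    rfl
  ext x
  obtain ⟨n, rfl⟩ := hg x
  simp only [map_zpow, hgen]

theorem norm_surjective {q ν : ℕ} [Fact q.Prime] {F : Type*} [Field F]
    [Fintype F] [Algebra (ZMod q) F] (hF : Fintype.card F = q ^ ν) {N : Fˣ →* (ZMod q)ˣ}
    (hN : ∀ x : Fˣ, algebraMap (ZMod q) F ((N x : (ZMod q)ˣ) : ZMod q) =
      (x : F) ^ ((q ^ ν - 1) / (q - 1))) : Function.Surjective N := by
  have hq : 1 < q := (Fact.out : q.Prime).one_lt
  obtain ⟨g, hg⟩ := IsCyclic.exists_generator (α := Fˣ)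
  have hog : orderOf g = q ^ ν - 1 := by
    rw [orderOf_eq_card_of_forall_mem_zpowers hg, Nat.card_units, Nat.card_eq_fintype_card, hF]
  have hM : (q ^ ν - 1) / (q - 1) * (q - 1) = q ^ ν - 1 :=
    Nat.div_mul_cancel (by simpa using Nat.sub_dvd_pow_sub_pow q 1 ν)
  have hM0 : 0 < (q ^ ν - 1) / (q - 1) := by
    have : 0 < q ^ ν - 1 := hog ▸ orderOf_pos g
    rw [← hM] at this
    exact Nat.pos_of_mul_pos_right this
  have hdvd : q - 1 ∣ orderOf (N g) := by
    have h1 : g ^ ((q ^ ν - 1) / (q - 1) * orderOf (N g)) = 1 := by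
      apply Units.ext
      rw [pow_mul, Units.val_pow_eq_pow_val, Units.val_pow_eq_pow_val, ← hN, ← map_pow,
        ← Units.val_pow_eq_pow_val, pow_orderOf_eq_one]
      simp
    have h2 := orderOf_dvd_of_pow_eq_one h1
    rw [hog] at h2
    exact Nat.dvd_of_mul_dvd_mul_left hM0 (hM.symm ▸ h2)
  have hcard : Nat.card (ZMod q)ˣ = q - 1 := by
    rw [Nat.card_eq_fintype_card, ZMod.card_units]
  have hord : orderOf (N g) = Nat.card (ZMod q)ˣ :=
    Nat.dvd_antisymm (orderOf_dvd_natCard _) (hcard ▸ hdvd)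
  intro y
  obtain ⟨n, hn⟩ : y ∈ Subgroup.zpowers (N g) := by
    rw [Subgroup.eq_top_of_card_eq _ ((Nat.card_zpowers _).trans hord)]
    trivial
  exact ⟨g ^ n, by simpa using hn⟩

/-- Lemma 5.4 (`how-to-twist`): a tuple with Property NIO can be twisted, possibly after a
finite extension of scalars via the norm map, into a tuple with Property CGM. -/
theorem NIO_twist_to_CGM (q : ℕ) [Fact (Nat.Prime q)] (k : ℕ) (hk : 1 ≤ k)
    (χ : Fin k → ((ZMod q)ˣ →* ℂˣ)) (hχ : HasNIO χ) :
    ∃ ν : ℕ, 1 ≤ ν ∧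
      ∀ (F : Type) [Field F] [Fintype F] [Algebra (ZMod q) F],
        Fintype.card F = q ^ ν →
        ∀ N : Fˣ →* (ZMod q)ˣ,
          (∀ x : Fˣ, algebraMap (ZMod q) F ((N x : (ZMod q)ˣ) : ZMod q) =
            (x : F) ^ ((q ^ ν - 1) / (q - 1))) →
          ∃ χ0 : Fˣ →* ℂˣ, HasCGM (fun i => χ0 * ((χ i).comp N)) := by
  have hq : q.Prime := Fact.out
  obtain ⟨a, m, hqm, hkm⟩ :=
    Nat.exists_eq_pow_mul_and_not_dvd (Nat.one_le_iff_ne_zero.1 hk) q hq.ne_one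
  have hm : m ≠ 0 := fun h => hqm (h ▸ dvd_zero q)
  have hq1 : 0 < q - 1 := Nat.sub_pos_of_lt hq.one_lt
  have hcop : Nat.Coprime q (m * (q - 1)) :=
    Nat.Coprime.mul_right ((Nat.Prime.coprime_iff_not_dvd hq).2 hqm)
      ((Nat.Prime.coprime_iff_not_dvd hq).2
        (Nat.not_dvd_of_pos_of_lt hq1 (Nat.sub_lt hq.pos one_pos)))
  refine ⟨Nat.totient (m * (q - 1)),
    Nat.totient_pos.2 (Nat.mul_pos (Nat.pos_of_ne_zero hm) hq1), ?_⟩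
  intro F _ _ _ hF N hN
  have hdvd : m * (q - 1) ∣ Nat.card Fˣ := by
    rw [Nat.card_units, Nat.card_eq_fintype_card, hF]
    exact (Nat.modEq_iff_dvd' (Nat.one_le_pow _ _ hq.pos)).1 (Nat.ModEq.pow_totient hcop).symm
  refine hχ.exists_hasCGM_twist hk (norm_surjective hF hN) fun n hn ψ => ?_
  obtain ⟨χ0, h0⟩ := exists_pow_eq_comp (a := a) hq.one_le hm
    (fun x => ZMod.units_pow_card_sub_one_eq_one q x) hdvd N ψ
  refine ⟨χ0 ^ (k / n), ?_⟩
  rw [← h0, ← hkm]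
  conv_rhs => rw [← Nat.div_mul_cancel hn]
  exact (pow_mul χ0 (k / n) n).symm
end

section
/- Fix integers k ≥ 2 and l ≥ 2, and let F be an algebraically closed field whose characteristic is zero or does not divide k. Define Z̃(F) = {(r, b) ∈ F × F^{2l} : there exists x = (x_1,…,x_{2l}) ∈ F^{2l} with x_i^k = r + b_i for all 1 ≤ i ≤ 2l and x_1 + ⋯ + x_l = x_{l+1} + ⋯ + x_{2l}}, and Z(F) = Z̃(F) ∪ ⋃_{i=1}^{2l} {(r, b) ∈ F × F^{2l} : r + b_i = 0}. Then there exists a nonzero polynomial P ∈ F[r, b_1,…,b_{2l}] whose zero set in F^{1+2l} is exactly Z(F), and which moreover satisfies: for every b ∈ F^{2l} not lying in the diagonal set V^Δ(F), the one-variable polynomial r ↦ P(r, b) in F[r] is not the zero polynomial. -/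
namespace MvPolynomial

theorem coeff_aeval_C_mul_X {σ R : Type*} [CommSemiring R] (h : σ → R) (p : MvPolynomial σ R)
    (d : σ →₀ ℕ) :
    coeff d (aeval (fun i => C (h i) * X i) p) = (d.prod fun i e => h i ^ e) * coeff d p := by
  classical
  induction p using MvPolynomial.induction_on' with
  | monomial m a =>
    have : aeval (fun i => C (h i) * X i) (monomial m a) =
        monomial m ((m.prod fun i e => h i ^ e) * a) := by
      rw [aeval_monomial, algebraMap_eq, monomial_eq (s := m), C_mul, Finsupp.prod, Finsupp.prod,
        Finsupp.prod, map_prod]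
      simp only [mul_pow, Finset.prod_mul_distrib, C_pow]
      ring
    rw [this, coeff_monomial, coeff_monomial]
    split_ifs with hm
    · rw [hm]
    · rw [mul_zero]
  | add p q hp hq => rw [map_add, coeff_add, hp, hq, coeff_add, mul_add]

theorem exists_expand_eq_of_forall_dvd {σ R : Type*} [CommSemiring R] {k : ℕ}
    (p : MvPolynomial σ R) (hp : ∀ d ∈ p.support, ∀ i, k ∣ d i) : ∃ q, expand k q = p := by
  have key : ∀ d ∈ p.support, ∃ q, expand k q = monomial d (coeff d p) := by
    intro d hd
    refine ⟨monomial (d.mapRange (· / k) (Nat.zero_div k)) (coeff d p), ?_⟩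
    rw [expand_monomial]
    refine congrArg (fun m => monomial m (coeff d p)) ?_
    ext i
    simpa using Nat.mul_div_cancel' (hp d hd i)
  choose! q hq using key
  refine ⟨∑ d ∈ p.support, q d, ?_⟩
  rw [map_sum, Finset.sum_congr rfl hq, support_sum_monomial_coeff]

/-- A polynomial invariant under rescaling each variable by `k`-th roots of unity is a polynomial
in the `k`-th powers of the variables. -/
theorem exists_expand_eq_of_invariant {σ F : Type*} [Field F] {k : ℕ} [NeZero k]
    [HasEnoughRootsOfUnity F k] (p : MvPolynomial σ F)
    (hp : ∀ h : σ → rootsOfUnity k F,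
      aeval (fun i => C (((h i : Fˣ) : F)) * X i) p = p) : ∃ q, expand k q = p := by
  classical
  obtain ⟨ζ, hζ⟩ := HasEnoughRootsOfUnity.exists_primitiveRoot F k
  refine exists_expand_eq_of_forall_dvd p fun d hd i => ?_
  have h1 := congrArg (coeff d) (hp (Pi.mulSingle i hζ.toRootsOfUnity))
  rw [coeff_aeval_C_mul_X] at h1
  have h2 := mul_right_cancel₀ (mem_support_iff.mp hd) (h1.trans (one_mul _).symm)
  rw [Finsupp.prod, Finset.prod_eq_single i] at h2
  · rw [Pi.mulSingle_eq_same] at h2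
    exact hζ.dvd_of_pow_eq_one _ h2
  · intro j _ hj
    simp [Pi.mulSingle_eq_of_ne hj]
  · intro hi
    simp [Finsupp.notMem_support_iff.mp hi]

theorem exists_expand_eq_prod_linear {σ F : Type*} [Fintype σ] [DecidableEq σ] [Field F] {k : ℕ}
    [NeZero k] [HasEnoughRootsOfUnity F k] [Fintype (rootsOfUnity k F)] (c : σ → F) :
    ∃ q : MvPolynomial σ F, expand k q =
      ∏ g : σ → rootsOfUnity k F, ∑ i, C (c i * ((g i : Fˣ) : F)) * X i := by
  refine exists_expand_eq_of_invariant _ fun h => ?_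
  rw [map_prod]
  refine Fintype.prod_equiv (Equiv.mulRight h) _ _ fun g => ?_
  rw [map_sum]
  refine Finset.sum_congr rfl fun i _ => ?_
  simp only [map_mul, aeval_C, aeval_X, algebraMap_eq, Equiv.coe_mulRight, Pi.mul_apply,
    Subgroup.coe_mul, Units.val_mul]
  ring

end MvPolynomial

theorem PowerSeries.exists_pow_eq_C_add_X_pow {F : Type*} [Field F] [IsAlgClosed F] {k : ℕ}
    (hk : 2 ≤ k) (hkF : (k : F) ≠ 0) {c : F} (hc : c ≠ 0) :
    ∃ y : PowerSeries F, y ^ k = C c + X ^ k ∧ coeff 1 y = 0 := by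
  have hk0 : k ≠ 0 := by omega
  obtain ⟨a, ha⟩ := IsAlgClosed.exists_pow_nat_eq c (Nat.pos_of_ne_zero hk0)
  have ha0 : a ≠ 0 := by
    rintro rfl
    exact hc (by rw [← ha, zero_pow hk0])
  obtain ⟨y, hy, -⟩ := HenselianRing.is_henselian (I := Ideal.span {(X : PowerSeries F)})
    (Polynomial.X ^ k - Polynomial.C (C c + X ^ k))
    (Polynomial.monic_X_pow_sub_C _ hk0) (C a)
    (by
      rw [Ideal.mem_span_singleton, X_dvd_iff]
      simp [ha, hk0])
    (by
      refine IsUnit.map _ ?_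
      rw [isUnit_iff_constantCoeff]
      rw [Polynomial.derivative_sub, Polynomial.derivative_C, sub_zero,
        Polynomial.derivative_X_pow]
      simp [hkF, ha0])
  have hy' : y ^ k = C c + X ^ k := by
    simpa [Polynomial.IsRoot, sub_eq_zero] using hy
  refine ⟨y, hy', ?_⟩
  have h0 := congrArg constantCoeff hy'
  have h1 := congrArg (coeff 1) hy'
  rw [coeff_one_pow] at h1
  have hy0 : constantCoeff y ≠ 0 := by
    intro h
    simp [h, hk0] at h0
    exact hc h0.symm
  have hk1 : (1 : ℕ) ≠ k := by omega
  simpa [hkF, hy0, coeff_X_pow, coeff_C, hk1] using h1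

/-- The norm of a linear form with nonzero coefficients in the `k`-th roots of the variables. -/
theorem MvPolynomial.exists_norm_linear {σ F : Type*} [Fintype σ] [DecidableEq σ] [Field F]
    [IsAlgClosed F] {k : ℕ} (hk : 2 ≤ k) (hkF : (k : F) ≠ 0) (c : σ → F) (hc : ∀ i, c i ≠ 0) :
    ∃ Q : MvPolynomial σ F,
      (∀ s : σ → F, eval s Q = 0 ↔ ∃ x : σ → F, (∀ i, x i ^ k = s i) ∧ ∑ i, c i * x i = 0) ∧
      ∀ (s : σ → F) (i₀ : σ), s i₀ = 0 → (∀ j, j ≠ i₀ → s j ≠ 0) →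
        aeval (fun i => PowerSeries.C (s i) + PowerSeries.X ^ k) Q ≠ (0 : PowerSeries F) := by
  have hk0 : k ≠ 0 := by omega
  have : NeZero k := ⟨hk0⟩
  have : NeZero (k : F) := ⟨hkF⟩
  have : Fintype (rootsOfUnity k F) := Fintype.ofFinite _
  obtain ⟨Q, hQ⟩ := exists_expand_eq_prod_linear (k := k) c
  refine ⟨Q, fun s => ?_, fun s i₀ hi₀ hs => ?_⟩
  · choose y hy using fun i => IsAlgClosed.exists_pow_nat_eq (s i) (Nat.pos_of_ne_zero hk0)
    have hs : s = y ^ k := by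
      funext i
      exact (hy i).symm
    rw [hs, ← eval_expand, hQ, map_prod, Finset.prod_eq_zero_iff]
    simp only [Finset.mem_univ, true_and, map_sum, map_mul, eval_C, eval_X, Pi.pow_apply]
    constructor
    · rintro ⟨g, hg⟩
      refine ⟨fun i => ((g i : Fˣ) : F) * y i, fun i => ?_, by simpa only [mul_assoc] using hg⟩
      have hgi : ((g i : Fˣ) : F) ^ k = 1 := (mem_rootsOfUnity' k _).mp (g i).2
      rw [mul_pow, hgi, one_mul]
    · rintro ⟨x, hx, hsum⟩
      have key : ∀ i, ∃ g : rootsOfUnity k F, ((g : Fˣ) : F) * y i = x i := by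
        intro i
        by_cases h0 : y i = 0
        · refine ⟨1, ?_⟩
          have := hx i
          rw [h0, zero_pow hk0] at this
          rw [h0, mul_zero, eq_zero_of_pow_eq_zero this]
        · refine ⟨rootsOfUnity.mkOfPowEq (x i / y i) ?_, ?_⟩
          · rw [div_pow, hx i, div_self (pow_ne_zero k h0)]
          · simp [h0]
      choose g hg using key
      exact ⟨g, by simpa only [mul_assoc, hg] using hsum⟩
  · have key : ∀ i, ∃ y : PowerSeries F, y ^ k = PowerSeries.C (s i) + PowerSeries.X ^ k ∧
        PowerSeries.coeff 1 y = if i = i₀ then 1 else 0 := by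
      intro i
      split_ifs with h
      · exact ⟨PowerSeries.X, by simp [h, hi₀], PowerSeries.coeff_one_X⟩
      · exact PowerSeries.exists_pow_eq_C_add_X_pow hk hkF (hs i h)
    choose y hy hy1 using key
    have hs' : (fun i => PowerSeries.C (s i) + PowerSeries.X ^ k) = y ^ k := by
      funext i
      exact (hy i).symm
    rw [hs', ← aeval_expand, hQ, map_prod, Finset.prod_ne_zero_iff]
    intro g _ h
    have h1 := congrArg (PowerSeries.coeff 1) h
    simp only [map_sum, map_mul, aeval_C, aeval_X, PowerSeries.algebraMap_eq, mul_assoc,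
      PowerSeries.coeff_C_mul, hy1] at h1
    simp [hc] at h1

theorem sum_ite_sign_mul {F : Type*} [Field F] (l : ℕ) (x : Fin (2 * l) → F) :
    ∑ i : Fin (2 * l), (if i.1 < l then (1 : F) else -1) * x i =
      (∑ i : Fin l, x ⟨i.1, by have := i.2; omega⟩) -
        ∑ i : Fin l, x ⟨i.1 + l, by have := i.2; omega⟩ := by
  rw [← (finCongr (two_mul l).symm).sum_comp, Fin.sum_univ_add, sub_eq_add_neg,
    ← Finset.sum_neg_distrib]
  congr 1 <;> refine Finset.sum_congr rfl fun i _ => ?_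
  · simp
    rfl
  · simp
    rfl

/-- Lemma 6.4 (`z-polynomial`): over an algebraically closed field of characteristic zero
or prime to `k`, the set `Z` is a hypersurface cut out by a polynomial `P` whose
specialization in the `r`-variable is nonzero away from the diagonal. -/
theorem z_polynomial (k l : ℕ) (hk : 2 ≤ k) (hl : 2 ≤ l)
    (F : Type) [Field F] [IsAlgClosed F]
    (hchar : ringChar F = 0 ∨ ¬ (ringChar F ∣ k)) :
    ∃ P : MvPolynomial (Unit ⊕ Fin (2 * l)) F, P ≠ 0 ∧
      (∀ (r : F) (b : Fin (2 * l) → F),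
        MvPolynomial.eval (Sum.elim (fun _ => r) b) P = 0 ↔
          ((∃ x : Fin (2 * l) → F,
              (∀ i, x i ^ k = r + b i) ∧
              (∑ i : Fin l, x ⟨i.1, by have := i.2; omega⟩) =
                ∑ i : Fin l, x ⟨i.1 + l, by have := i.2; omega⟩) ∨
            (∃ i, r + b i = 0))) ∧
      (∀ b : Fin (2 * l) → F, ¬ (∀ i, ∃ j, j ≠ i ∧ b j = b i) →
        MvPolynomial.aeval
          (Sum.elim (fun _ : Unit => (Polynomial.X : Polynomial F))
            (fun i => Polynomial.C (b i))) P ≠ 0) := by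
  have hkF : (k : F) ≠ 0 := by
    rw [Ne, ringChar.spec]
    rcases hchar with h | h
    · rw [h, zero_dvd_iff]
      omega
    · exact h
  obtain ⟨Q, hQ0, hQ⟩ := MvPolynomial.exists_norm_linear (σ := Fin (2 * l)) hk hkF
    (fun i => if i.1 < l then (1 : F) else -1) (fun i => by split_ifs <;> simp)
  let P : MvPolynomial (Unit ⊕ Fin (2 * l)) F :=
    MvPolynomial.aeval (fun i => MvPolynomial.X (Sum.inl ()) + MvPolynomial.X (Sum.inr i))
      (Q * ∏ i, MvPolynomial.X i)
  have hP : ∀ (A : Type) [CommRing A] [Algebra F A] (r : A) (b : Fin (2 * l) → A),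
      MvPolynomial.aeval (Sum.elim (fun _ => r) b) P =
        MvPolynomial.aeval (fun i => r + b i) Q * ∏ i, (r + b i) := by
    intro A _ _ r b
    rw [← AlgHom.comp_apply, MvPolynomial.comp_aeval]
    simp
  have hne : ∀ b : Fin (2 * l) → F, ¬ (∀ i, ∃ j, j ≠ i ∧ b j = b i) →
      MvPolynomial.aeval
        (Sum.elim (fun _ : Unit => (Polynomial.X : Polynomial F))
          (fun i => Polynomial.C (b i))) P ≠ 0 := by
    intro b hb h
    push Not at hb
    obtain ⟨i₀, hi₀⟩ := hb
    rw [hP] at h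
    rcases mul_eq_zero.mp h with h | h
    · refine hQ (fun i => b i - b i₀) i₀ (sub_self _) (fun j hj => sub_ne_zero.mpr (hi₀ j hj)) ?_
      have h' := congrArg (Polynomial.aeval
        (PowerSeries.X ^ k - PowerSeries.C (b i₀) : PowerSeries F)) h
      rw [← AlgHom.comp_apply, MvPolynomial.comp_aeval, map_zero] at h'
      rw [← h']
      congr 2
      funext i
      simp only [map_add, map_sub, Polynomial.aeval_X, Polynomial.aeval_C,
        PowerSeries.algebraMap_eq]
      ring
    · obtain ⟨i, -, hi⟩ := Finset.prod_eq_zero_iff.mp h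
      exact Polynomial.X_add_C_ne_zero _ hi
  refine ⟨P, ?_, fun r b => ?_, hne⟩
  · intro h
    refine hne (Pi.single ⟨0, by omega⟩ 1) ?_ (by rw [h, map_zero])
    push Not
    refine ⟨⟨0, by omega⟩, fun j hj => ?_⟩
    simp [hj]
  · have h := hP F r b
    simp only [MvPolynomial.aeval_eq_eval] at h
    rw [h, mul_eq_zero, hQ0, Finset.prod_eq_zero_iff]
    simp only [sum_ite_sign_mul, sub_eq_zero, Finset.mem_univ, true_and]
end
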